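/- Let A be an artin algebra and C a component of Γ_A without external short paths such that some faithful module M in add(C) exists. Then for every indecomposable projective A-module P and every indecomposable direct summand X of rad P not lying in C, the projective dimension of X is at most 1; consequently the global dimension of A is at most 2. -/

import Mathlib

universe u

variable {A : Type u} [Ring A]

/-- The category of (right) `A`-modules, modeled as modules over `Aᵐᵒᵖ`. -/
abbrev Modc (A : Type u) [Ring A] := ModuleCat.{u} Aᵐᵒᵖ

/-- A module is finitely generated. -/
def FinGen (M : Modc A) : Prop := Module.Finite Aᵐᵒᵖ M

/-- A module is indecomposable: nonzero, and its endomorphism ring has no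
nontrivial idempotents. -/
def Indec (M : Modc A) : Prop :=
  Nontrivial M ∧ ∀ e : M →ₗ[Aᵐᵒᵖ] M, e ∘ₗ e = e → e = 0 ∨ e = LinearMap.id

def IsSplitMono {M N : Modc A} (f : M →ₗ[Aᵐᵒᵖ] N) : Prop :=
  ∃ g : N →ₗ[Aᵐᵒᵖ] M, g ∘ₗ f = LinearMap.id

def IsSplitEpi {M N : Modc A} (f : M →ₗ[Aᵐᵒᵖ] N) : Prop :=
  ∃ g : N →ₗ[Aᵐᵒᵖ] M, f ∘ₗ g = LinearMap.id

/-- An irreducible morphism between modules. -/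
def IsIrred {M N : Modc A} (f : M →ₗ[Aᵐᵒᵖ] N) : Prop :=
  ¬ IsSplitMono f ∧ ¬ IsSplitEpi f ∧
  ∀ (L : Modc A) (g : M →ₗ[Aᵐᵒᵖ] L) (h : L →ₗ[Aᵐᵒᵖ] N),
    h ∘ₗ g = f → IsSplitEpi h ∨ IsSplitMono g

/-- Neighbors in the Auslander-Reiten quiver: both finitely generated
indecomposable, and isomorphic or linked by an irreducible map. -/
def Neighbor (X Y : Modc A) : Prop :=
  FinGen X ∧ FinGen Y ∧ Indec X ∧ Indec Y ∧
  (Nonempty (X ≃ₗ[Aᵐᵒᵖ] Y) ∨ (∃ f : X →ₗ[Aᵐᵒᵖ] Y, IsIrred f) ∨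
    (∃ f : Y →ₗ[Aᵐᵒᵖ] X, IsIrred f))

/-- A component of the Auslander-Reiten quiver `Γ_A`, viewed as the class of
indecomposable finitely generated modules lying in it. -/
def IsARComponent (C : Set (Modc A)) : Prop :=
  C.Nonempty ∧ (∀ X ∈ C, FinGen X ∧ Indec X) ∧
  (∀ X ∈ C, ∀ Y : Modc A, Neighbor X Y → Y ∈ C) ∧
  (∀ X ∈ C, ∀ Y ∈ C, Relation.ReflTransGen Neighbor X Y)

/-- The annihilator of a class of modules. -/
def annSet (C : Set (Modc A)) : Set A :=
  {a | ∀ X ∈ C, ∀ x : X, MulOpposite.op a • x = 0}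

/-- The annihilator of a single module. -/
def annM (M : Modc A) : Set A := {a | ∀ x : M, MulOpposite.op a • x = 0}

/-- Membership in `add C`: isomorphic to a finite direct sum of modules in `C`. -/
def InAdd (C : Set (Modc A)) (M : Modc A) : Prop :=
  ∃ (k : ℕ) (F : Fin k → Modc A), (∀ i, F i ∈ C) ∧
    Nonempty (M ≃ₗ[Aᵐᵒᵖ] ((i : Fin k) → F i))

/-- An external short path of `C`: nonzero non-isomorphisms `X → Y → Z` between
indecomposables with `X, Z ∈ C` and `Y ∉ C`. -/
def HasExtShortPath (C : Set (Modc A)) : Prop :=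
  ∃ X Y Z : Modc A, X ∈ C ∧ Z ∈ C ∧ Y ∉ C ∧ FinGen Y ∧ Indec Y ∧
    (∃ f : X →ₗ[Aᵐᵒᵖ] Y, f ≠ 0 ∧ ¬ Function.Bijective f) ∧
    (∃ g : Y →ₗ[Aᵐᵒᵖ] Z, g ≠ 0 ∧ ¬ Function.Bijective g)

/-- Projective dimension at most one. -/
def PdLE1 (X : Modc A) : Prop :=
  ∃ (P₁ P₀ : Modc A) (f : P₁ →ₗ[Aᵐᵒᵖ] P₀) (g : P₀ →ₗ[Aᵐᵒᵖ] X),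
    Module.Projective Aᵐᵒᵖ P₁ ∧ Module.Projective Aᵐᵒᵖ P₀ ∧
    Function.Injective f ∧ Function.Surjective g ∧
    LinearMap.range f = LinearMap.ker g

/-- Projective dimension at most two. -/
def PdLE2 (X : Modc A) : Prop :=
  ∃ (P₂ P₁ P₀ : Modc A) (f : P₂ →ₗ[Aᵐᵒᵖ] P₁) (g : P₁ →ₗ[Aᵐᵒᵖ] P₀)
    (h : P₀ →ₗ[Aᵐᵒᵖ] X),
    Module.Projective Aᵐᵒᵖ P₂ ∧ Module.Projective Aᵐᵒᵖ P₁ ∧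
    Module.Projective Aᵐᵒᵖ P₀ ∧
    Function.Injective f ∧ Function.Surjective h ∧
    LinearMap.range f = LinearMap.ker g ∧ LinearMap.range g = LinearMap.ker h

/-- Injective dimension at most one. -/
def IdLE1 (X : Modc A) : Prop :=
  ∃ (I₀ I₁ : Modc A) (f : X →ₗ[Aᵐᵒᵖ] I₀) (g : I₀ →ₗ[Aᵐᵒᵖ] I₁),
    Module.Injective Aᵐᵒᵖ I₀ ∧ Module.Injective Aᵐᵒᵖ I₁ ∧
    Function.Injective f ∧ Function.Surjective g ∧
    LinearMap.range f = LinearMap.ker g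

/-- An almost split (Auslander-Reiten) sequence `0 → T → E → X → 0`; then
`T = τ_A X` and `X = τ_A⁻ T`. -/
def IsAlmostSplitSeq (T E X : Modc A) (f : T →ₗ[Aᵐᵒᵖ] E) (g : E →ₗ[Aᵐᵒᵖ] X) : Prop :=
  Function.Injective f ∧ Function.Surjective g ∧
  LinearMap.range f = LinearMap.ker g ∧
  Indec T ∧ Indec X ∧ ¬ IsSplitEpi g ∧
  (∀ (V : Modc A) (h : V →ₗ[Aᵐᵒᵖ] X), ¬ IsSplitEpi h → ∃ k : V →ₗ[Aᵐᵒᵖ] E, g ∘ₗ k = h) ∧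
  (∀ (V : Modc A) (h : T →ₗ[Aᵐᵒᵖ] V), ¬ IsSplitMono h → ∃ k : E →ₗ[Aᵐᵒᵖ] V, k ∘ₗ f = h)

/-- A generator of the radical of `mod A`: a map factoring through a
non-isomorphism between finitely generated indecomposables. -/
def IsNonIsoGen {X Y : Modc A} (f : X →ₗ[Aᵐᵒᵖ] Y) : Prop :=
  ∃ (M N : Modc A) (u : M →ₗ[Aᵐᵒᵖ] N) (g : X →ₗ[Aᵐᵒᵖ] M) (h : N →ₗ[Aᵐᵒᵖ] Y),
    FinGen M ∧ Indec M ∧ FinGen N ∧ Indec N ∧ ¬ Function.Bijective u ∧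
    f = h ∘ₗ (u ∘ₗ g)

/-- The radical `rad_A(X, Y)`: the ideal of `mod A` generated by all
non-isomorphisms between indecomposables. -/
def rad1 (X Y : Modc A) : AddSubgroup (X →ₗ[Aᵐᵒᵖ] Y) :=
  AddSubgroup.closure {f | IsNonIsoGen f}

/-- Powers of the radical: `radPow n = rad_A^(n+1)`. -/
def radPow : ℕ → (X Y : Modc A) → AddSubgroup (X →ₗ[Aᵐᵒᵖ] Y)
  | 0 => rad1
  | n + 1 => fun X Y => AddSubgroup.closure
      {f | ∃ (Z : Modc A) (g : X →ₗ[Aᵐᵒᵖ] Z) (h : Z →ₗ[Aᵐᵒᵖ] Y),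
        FinGen Z ∧ g ∈ radPow n X Z ∧ h ∈ rad1 Z Y ∧ f = h ∘ₗ g}

/-- The infinite radical `rad_A^∞(X, Y) = ⋂_{i ≥ 1} rad_A^i(X, Y)`. -/
def radInf (X Y : Modc A) : AddSubgroup (X →ₗ[Aᵐᵒᵖ] Y) := ⨅ n : ℕ, radPow n X Y

/-- `X` is (isomorphic to) a direct summand of `M`. -/
def IsDirectSummandOf (X M : Modc A) : Prop :=
  ∃ (ι : X →ₗ[Aᵐᵒᵖ] M) (ρ : M →ₗ[Aᵐᵒᵖ] X), ρ ∘ₗ ι = LinearMap.id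



/-- The radical of a module: the intersection of its maximal submodules. -/
def radMod {A : Type u} [Ring A] (P : Modc A) : Submodule Aᵐᵒᵖ P :=
  sInf {m : Submodule Aᵐᵒᵖ P | IsCoatom m}

section Homological

variable {R M : Type u} [Ring R] [AddCommGroup M] [Module R M]

/-- A faithful module over a left artinian ring has a finite subset with zero annihilator. -/
lemma exists_finset_annihilator_eq_zero [IsArtinianRing R]
    (hM : ∀ r : R, (∀ m : M, r • m = 0) → r = 0) :
    ∃ s : Finset M, ∀ r : R, (∀ m ∈ s, r • m = 0) → r = 0 := by
  obtain ⟨s, hs⟩ := Finset.exists_inf_le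
    (fun m : M => LinearMap.ker (LinearMap.toSpanSingleton R M m))
  refine ⟨s, fun r hr => hM r fun m => ?_⟩
  have hmem : r ∈ s.inf (fun m : M => LinearMap.ker (LinearMap.toSpanSingleton R M m)) := by
    rw [Submodule.mem_finsetInf]
    intro m hm
    simpa using hr m hm
  simpa using hs m hmem

/-- Injective modules are generated by any faithful module over a left artinian ring. -/
lemma Module.Injective.iSup_range_eq_top [IsArtinianRing R]
    (hM : ∀ r : R, (∀ m : M, r • m = 0) → r = 0)
    (I : Type u) [AddCommGroup I] [Module R I] [Module.Injective R I] :
    ⨆ f : M →ₗ[R] I, LinearMap.range f = ⊤ := by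
  classical
  obtain ⟨s, hs⟩ := exists_finset_annihilator_eq_zero hM
  rw [eq_top_iff]
  intro x _
  let j : R →ₗ[R] (s → M) := LinearMap.pi fun m => LinearMap.toSpanSingleton R M m
  have hj : Function.Injective j := by
    rw [injective_iff_map_eq_zero]
    intro r hr
    exact hs r fun m hm => by simpa [j] using congrFun hr ⟨m, hm⟩
  obtain ⟨φ, hφ⟩ := Module.Injective.out j hj (LinearMap.toSpanSingleton R I x)
  have hx : φ (j 1) = x := by simpa using hφ 1
  rw [← hx, ← Finset.univ_sum_single (j 1), map_sum]
  exact Submodule.sum_mem _ fun m _ => Submodule.mem_iSup_of_mem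
    (φ ∘ₗ LinearMap.single R (fun _ : s => M) m) ⟨j 1 m, rfl⟩

/-- Quotients of modules generated by `M` are generated by `M`. -/
lemma iSup_range_eq_top_of_surjective {I Q : Type u} [AddCommGroup I] [Module R I]
    [AddCommGroup Q] [Module R Q] (hI : ⨆ f : M →ₗ[R] I, LinearMap.range f = ⊤)
    (q : I →ₗ[R] Q) (hq : Function.Surjective q) :
    ⨆ f : M →ₗ[R] Q, LinearMap.range f = ⊤ := by
  rw [eq_top_iff, ← LinearMap.range_eq_top.mpr hq, LinearMap.range_eq_map, ← hI,
    Submodule.map_iSup]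
  refine iSup_le fun f => ?_
  rw [← LinearMap.range_comp]
  exact le_iSup (fun f : M →ₗ[R] Q => LinearMap.range f) (q ∘ₗ f)

/-- If every finitely generated module `E` has an endomorphism killing all maps from `M` and
absorbed by all maps to `X`, then extensions of `X` by modules generated by `M` split: every map
from `ker π` to such a module extends to the source of `π`. -/
lemma exists_extension_of_iSup_range_eq_top {X P Q : Type u}
    [AddCommGroup X] [Module R X] [AddCommGroup P] [Module R P] [AddCommGroup Q] [Module R Q]
    [IsNoetherianRing R] [Module.Finite R M] [Module.Finite R P]
    (hX : ∀ (E : Type u) [AddCommGroup E] [Module R E], Module.Finite R E →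
      ∃ e : E →ₗ[R] E, (∀ f : M →ₗ[R] E, e ∘ₗ f = 0) ∧ ∀ g : E →ₗ[R] X, g ∘ₗ e = g)
    (π : P →ₗ[R] X)
    (hQ : ⨆ f : M →ₗ[R] Q, LinearMap.range f = ⊤) (θ : LinearMap.ker π →ₗ[R] Q) :
    ∃ ψ : P →ₗ[R] Q, ∀ w : LinearMap.ker π, ψ w = θ w := by
  have hfg : (LinearMap.range θ).FG := by
    rw [LinearMap.range_eq_map]
    exact (IsNoetherian.noetherian ⊤).map θ
  obtain ⟨s, hs⟩ := CompleteLattice.IsCompactElement.exists_finset_of_le_iSup _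
    ((Submodule.fg_iff_compact _).mp hfg) (fun f : M →ₗ[R] Q => LinearMap.range f)
    (le_top.trans hQ.ge)
  set S : Submodule R Q := ⨆ f ∈ s, LinearMap.range f with hS
  have hSfg : S.FG := Submodule.fg_biSup _ _ fun f _ => by
    rw [LinearMap.range_eq_map]
    exact Module.Finite.fg_top.map f
  have : Module.Finite R S := Module.Finite.iff_fg.mpr hSfg
  let θ' : LinearMap.ker π →ₗ[R] S := θ.codRestrict S fun w => hs ⟨w, rfl⟩
  let W : Submodule R (S × P) := LinearMap.range (θ'.prod (-(LinearMap.ker π).subtype))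
  let ι : S →ₗ[R] (S × P) ⧸ W := W.mkQ ∘ₗ LinearMap.inl R S P
  let p : P →ₗ[R] (S × P) ⧸ W := W.mkQ ∘ₗ LinearMap.inr R S P
  have hιp : ∀ w : LinearMap.ker π, p w = ι (θ' w) := by
    intro w
    rw [eq_comm, ← sub_eq_zero]
    simp only [ι, p, LinearMap.comp_apply, ← map_sub]
    rw [Submodule.mkQ_apply, Submodule.Quotient.mk_eq_zero]
    exact ⟨w, by simp⟩
  let ρ : (S × P) ⧸ W →ₗ[R] X := W.liftQ (π ∘ₗ LinearMap.snd R S P) (by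
    rintro _ ⟨w, rfl⟩
    simp)
  obtain ⟨e, he₁, he₂⟩ := hX ((S × P) ⧸ W) inferInstance
  have hι : Function.Injective ι := by
    rw [injective_iff_map_eq_zero]
    intro x hx
    obtain ⟨w, hw⟩ := (Submodule.Quotient.mk_eq_zero W).mp hx
    have h1 : θ' w = x := congrArg Prod.fst hw
    have h2 : w = 0 := by
      have := congrArg Prod.snd hw
      simpa using this
    rw [← h1, h2, map_zero]
  have heι : ∀ x : S, e (ι x) = 0 := by
    have key : ∀ f ∈ s, LinearMap.range f ≤
        (LinearMap.ker (e ∘ₗ ι)).map S.subtype := by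
      rintro f hf _ ⟨m, rfl⟩
      have hle : ∀ m, f m ∈ S := fun m =>
        (le_biSup (fun f : M →ₗ[R] Q => LinearMap.range f) hf) ⟨m, rfl⟩
      refine ⟨⟨f m, hle m⟩, ?_, rfl⟩
      exact LinearMap.congr_fun (he₁ (ι ∘ₗ f.codRestrict S hle)) m
    rintro ⟨x, hx⟩
    obtain ⟨y, hy, rfl⟩ := (iSup₂_le key : S ≤ _) hx
    exact hy
  have hrange : ∀ x, x - e x ∈ LinearMap.range ι := by
    intro x
    have h0 : ρ (x - e x) = 0 := by
      rw [map_sub, ← LinearMap.comp_apply, he₂, sub_self]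
    obtain ⟨⟨a, b⟩, hab⟩ := W.mkQ_surjective (x - e x)
    rw [← hab] at h0 ⊢
    have hb : b ∈ LinearMap.ker π := h0
    refine ⟨a + θ' ⟨b, hb⟩, ?_⟩
    rw [map_add, ← hιp]
    simp only [ι, p, LinearMap.comp_apply, ← map_add]
    simp
  let t := (LinearEquiv.ofInjective ι hι).symm.toLinearMap ∘ₗ
    (LinearMap.id - e).codRestrict (LinearMap.range ι) hrange
  have ht : ∀ x, t (ι x) = x := by
    intro x
    rw [LinearMap.comp_apply, LinearEquiv.coe_coe, LinearEquiv.symm_apply_eq]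
    ext
    simp [heι]
  refine ⟨S.subtype ∘ₗ t ∘ₗ p, fun w => ?_⟩
  simp only [LinearMap.comp_apply]
  rw [hιp, ht]
  rfl

/-- Under the splitting hypothesis of `exists_extension_of_iSup_range_eq_top`, first syzygies
of `X` are projective. -/
lemma projective_ker_of_forall_exists_endomorphism [IsArtinianRing R] [Module.Finite R M]
    (hM : ∀ r : R, (∀ m : M, r • m = 0) → r = 0) {X P : Type u}
    [AddCommGroup X] [Module R X] [AddCommGroup P] [Module R P]
    [Module.Finite R P] [Module.Projective R P]
    (hX : ∀ (E : Type u) [AddCommGroup E] [Module R E], Module.Finite R E →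
      ∃ e : E →ₗ[R] E, (∀ f : M →ₗ[R] E, e ∘ₗ f = 0) ∧ ∀ g : E →ₗ[R] X, g ∘ₗ e = g)
    (π : P →ₗ[R] X) : Module.Projective R (LinearMap.ker π) := by
  obtain ⟨n, q, hq⟩ := Module.Finite.exists_fin' R (LinearMap.ker π)
  let J := CategoryTheory.Injective.under (ModuleCat.of R (LinearMap.ker q))
  have hJ : Module.Injective R J :=
    (Module.injective_iff_injective_object R J).mpr
      (inferInstanceAs (CategoryTheory.Injective (CategoryTheory.Injective.under
        (ModuleCat.of R (LinearMap.ker q)))))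
  let i : LinearMap.ker q →ₗ[R] J :=
    (CategoryTheory.Injective.ι (ModuleCat.of R (LinearMap.ker q))).hom
  have hi : Function.Injective i :=
    (ModuleCat.mono_iff_injective _).mp
      (inferInstanceAs (CategoryTheory.Mono (CategoryTheory.Injective.ι _)))
  obtain ⟨φ, hφ⟩ := Module.Injective.out (LinearMap.ker q).subtype
    (LinearMap.ker q).injective_subtype i
  let N := LinearMap.range i
  have hker : LinearMap.ker q ≤ LinearMap.ker (N.mkQ ∘ₗ φ) := by
    intro x hx
    have : φ x = i ⟨x, hx⟩ := hφ ⟨x, hx⟩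
    simp [this, N]
  let θ : LinearMap.ker π →ₗ[R] J ⧸ N :=
    (LinearMap.ker q).liftQ (N.mkQ ∘ₗ φ) hker ∘ₗ
      (q.quotKerEquivOfSurjective hq).symm.toLinearMap
  have hθ : ∀ x, θ (q x) = N.mkQ (φ x) := by
    intro x
    have : (q.quotKerEquivOfSurjective hq).symm (q x) = (LinearMap.ker q).mkQ x := by
      rw [LinearEquiv.symm_apply_eq]
      rfl
    simp [θ, this]
  obtain ⟨ψ, hψ⟩ := exists_extension_of_iSup_range_eq_top hX π
    (iSup_range_eq_top_of_surjective (Module.Injective.iSup_range_eq_top hM J) N.mkQ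
      N.mkQ_surjective) θ
  obtain ⟨χ, hχ⟩ := Module.projective_lifting_property N.mkQ ψ N.mkQ_surjective
  have hmem : ∀ x, (φ - χ ∘ₗ (LinearMap.ker π).subtype ∘ₗ q) x ∈ N := by
    intro x
    rw [← Submodule.Quotient.mk_eq_zero, ← Submodule.mkQ_apply]
    have : N.mkQ (χ (q x)) = N.mkQ (φ x) := by
      rw [← LinearMap.comp_apply, hχ, hψ, hθ]
    rw [LinearMap.sub_apply, map_sub, sub_eq_zero]
    exact this.symm
  let r : (Fin n → R) →ₗ[R] LinearMap.ker q :=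
    (LinearEquiv.ofInjective i hi).symm.toLinearMap ∘ₗ
      (φ - χ ∘ₗ (LinearMap.ker π).subtype ∘ₗ q).codRestrict N hmem
  have hr : ∀ x : LinearMap.ker q, r x = x := by
    intro x
    rw [LinearMap.comp_apply, LinearEquiv.coe_coe, LinearEquiv.symm_apply_eq]
    ext
    have h1 : φ x = i x := hφ x
    have h2 : q x = 0 := x.2
    simp [h1, h2]
  have hker' : LinearMap.ker q ≤
      LinearMap.ker (LinearMap.id - (LinearMap.ker q).subtype ∘ₗ r) := by
    intro x hx
    have := congrArg Subtype.val (hr ⟨x, hx⟩)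
    rw [LinearMap.mem_ker, LinearMap.sub_apply, sub_eq_zero]
    exact this.symm
  let σ : LinearMap.ker π →ₗ[R] (Fin n → R) :=
    (LinearMap.ker q).liftQ _ hker' ∘ₗ (q.quotKerEquivOfSurjective hq).symm.toLinearMap
  refine Module.Projective.of_split σ q ?_
  ext1 y
  obtain ⟨x, rfl⟩ := hq y
  have : (q.quotKerEquivOfSurjective hq).symm (q x) = (LinearMap.ker q).mkQ x := by
    rw [LinearEquiv.symm_apply_eq]
    rfl
  simp [σ, this]

end Homological

/-- To prove a property of all finitely generated modules over a left artinian ring, it suffices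
to treat zero modules, indecomposable modules, and biproducts. -/
lemma finGen_induction [IsArtinianRing Aᵐᵒᵖ] {p : Modc A → Prop}
    (zero : ∀ E : Modc A, Subsingleton E → p E)
    (indec : ∀ E : Modc A, FinGen E → Indec E → p E)
    (sum : ∀ (E E₁ E₂ : Modc A) (j₁ : E₁ →ₗ[Aᵐᵒᵖ] E) (q₁ : E →ₗ[Aᵐᵒᵖ] E₁)
      (j₂ : E₂ →ₗ[Aᵐᵒᵖ] E) (q₂ : E →ₗ[Aᵐᵒᵖ] E₂), q₁ ∘ₗ j₁ = LinearMap.id →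
      q₂ ∘ₗ j₂ = LinearMap.id → j₁ ∘ₗ q₁ + j₂ ∘ₗ q₂ = LinearMap.id → p E₁ → p E₂ → p E)
    (E : Modc A) (hE : FinGen E) : p E := by
  have : Module.Finite Aᵐᵒᵖ E := hE
  have step : ∀ (F : Modc A), FinGen F →
      (∀ S : Submodule Aᵐᵒᵖ F, S < ⊤ → p (ModuleCat.of Aᵐᵒᵖ S)) → p F := by
    intro F hF ih
    by_cases hF0 : Subsingleton F
    · exact zero F hF0
    have hnt : Nontrivial F := not_subsingleton_iff_nontrivial.mp hF0
    by_cases hFi : Indec F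
    · exact indec F hF hFi
    have hex : ∃ e : F →ₗ[Aᵐᵒᵖ] F, e ∘ₗ e = e ∧ e ≠ 0 ∧ e ≠ LinearMap.id := by
      by_contra! h
      exact hFi ⟨hnt, fun e he => or_iff_not_imp_left.mpr (h e he)⟩
    obtain ⟨e, he, he0, he1⟩ := hex
    have he' : ∀ x, e (e x) = e x := LinearMap.congr_fun he
    have hlt : ∀ d : F →ₗ[Aᵐᵒᵖ] F, (∀ x, d (d x) = d x) → d ≠ LinearMap.id →
        LinearMap.range d < ⊤ := by
      intro d hd hd1
      refine lt_top_iff_ne_top.mpr fun h => hd1 ?_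
      ext1 x
      obtain ⟨y, rfl⟩ := LinearMap.range_eq_top.mp h x
      exact hd y
    have hsplit : ∀ d : F →ₗ[Aᵐᵒᵖ] F, (∀ x, d (d x) = d x) →
        d.rangeRestrict ∘ₗ (LinearMap.range d).subtype = LinearMap.id := by
      intro d hd
      ext1 x
      obtain ⟨_, y, rfl⟩ := x
      exact Subtype.ext (hd y)
    set d : F →ₗ[Aᵐᵒᵖ] F := LinearMap.id - e with hd
    have hc : ∀ x, d (d x) = d x := by
      intro x
      simp [hd, he']
    refine sum F (ModuleCat.of Aᵐᵒᵖ (LinearMap.range e))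
      (ModuleCat.of Aᵐᵒᵖ (LinearMap.range d))
      (LinearMap.range e).subtype e.rangeRestrict
      (LinearMap.range d).subtype d.rangeRestrict
      (hsplit e he') (hsplit _ hc) ?_ (ih _ (hlt e he' he1)) (ih _ (hlt _ hc ?_))
    · ext1 x
      simp [hd]
    · intro h
      exact he0 (by simpa [hd] using h)
  have equiv : ∀ E₁ E₂ : Modc A, (E₁ ≃ₗ[Aᵐᵒᵖ] E₂) → p E₁ → p E₂ := by
    intro E₁ E₂ e h
    exact sum E₂ E₁ (ModuleCat.of Aᵐᵒᵖ PUnit) e.toLinearMap e.symm.toLinearMap 0 0 (by ext; simp)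
      (Subsingleton.elim _ _) (by ext; simp) h (zero _ (inferInstanceAs (Subsingleton PUnit)))
  have hsub : ∀ S : Submodule Aᵐᵒᵖ E, p (ModuleCat.of Aᵐᵒᵖ S) := by
    intro S
    induction S using WellFoundedLT.induction with
    | ind S ih =>
      refine step _ (inferInstanceAs (Module.Finite Aᵐᵒᵖ S)) fun T hT => ?_
      refine equiv (ModuleCat.of Aᵐᵒᵖ (T.map S.subtype)) _
        (Submodule.equivMapOfInjective S.subtype S.injective_subtype T).symm (ih _ ?_)
      have := Submodule.map_strictMono_of_injective S.injective_subtype hT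
      rwa [Submodule.map_top, Submodule.range_subtype] at this
  exact step E hE fun S _ => hsub S

section Component

variable {C : Set (Modc A)} {M : Modc A}

lemma IsARComponent.mem_of_linearEquiv (hC : IsARComponent C) {X Y : Modc A} (hX : X ∈ C)
    (hY : FinGen Y) (hYi : Indec Y) (e : X ≃ₗ[Aᵐᵒᵖ] Y) : Y ∈ C :=
  hC.2.2.1 X hX Y ⟨(hC.2.1 X hX).1, hY, (hC.2.1 X hX).2, hYi, Or.inl ⟨e⟩⟩

lemma InAdd.finGen (hC : IsARComponent C) (hM : InAdd C M) : FinGen M := by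
  obtain ⟨k, F, hF, ⟨e⟩⟩ := hM
  have : ∀ i, Module.Finite Aᵐᵒᵖ (F i) := fun i => (hC.2.1 _ (hF i)).1
  exact Module.Finite.equiv e.symm

lemma InAdd.exists_ne_zero_from (hM : InAdd C M) {E : Modc A} {f : M →ₗ[Aᵐᵒᵖ] E} (hf : f ≠ 0) :
    ∃ Z ∈ C, ∃ g : Z →ₗ[Aᵐᵒᵖ] E, g ≠ 0 := by
  obtain ⟨k, F, hF, ⟨e⟩⟩ := hM
  by_contra! h
  refine hf ?_
  have h0 : f ∘ₗ e.symm.toLinearMap = 0 := by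
    refine LinearMap.pi_ext' fun i => ?_
    rw [h (F i) (hF i) ((f ∘ₗ e.symm.toLinearMap) ∘ₗ LinearMap.single Aᵐᵒᵖ (fun i => F i) i),
      LinearMap.zero_comp]
  ext1 x
  simpa using LinearMap.congr_fun h0 (e x)

lemma InAdd.exists_apply_ne_zero (hM : InAdd C M) {m : M} (hm : m ≠ 0) :
    ∃ Z ∈ C, ∃ g : M →ₗ[Aᵐᵒᵖ] Z, g m ≠ 0 := by
  obtain ⟨k, F, hF, ⟨e⟩⟩ := hM
  by_contra! h
  refine hm (e.injective ?_)
  rw [map_zero]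
  ext1 i
  exact h (F i) (hF i) (LinearMap.proj i ∘ₗ e.toLinearMap)

/-- A finitely generated indecomposable module outside `C` does not lie between
two modules of `C`. -/
lemma eq_zero_of_not_hasExtShortPath (hC : IsARComponent C) (hne : ¬ HasExtShortPath C)
    {E : Modc A} (hE : FinGen E) (hEi : Indec E) (hEC : E ∉ C) {X Z : Modc A} (hX : X ∈ C)
    (hZ : Z ∈ C) {g : E →ₗ[Aᵐᵒᵖ] Z} (hg : g ≠ 0) (f : X →ₗ[Aᵐᵒᵖ] E) : f = 0 := by
  by_contra hf
  exact hne ⟨X, E, Z, hX, hZ, hEC, hE, hEi,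
    ⟨f, hf, fun hb => hEC (hC.mem_of_linearEquiv hX hE hEi (LinearEquiv.ofBijective f hb))⟩,
    ⟨g, hg, fun hb => hEC
      (hC.mem_of_linearEquiv hZ hE hEi (LinearEquiv.ofBijective g hb).symm)⟩⟩

/-- A projective module is cogenerated by the modules of `C`. -/
lemma exists_apply_ne_zero_of_projective (hM : InAdd C M) (hfaith : annM M = {0}) {P : Modc A}
    (hP : Module.Projective Aᵐᵒᵖ P) {x : P} (hx : x ≠ 0) :
    ∃ Z ∈ C, ∃ g : P →ₗ[Aᵐᵒᵖ] Z, g x ≠ 0 := by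
  obtain ⟨φ, hφ⟩ := not_forall.mp
    (mt (Module.forall_dual_apply_eq_zero_iff Aᵐᵒᵖ x).mp hx)
  have hm : ∃ m : M, φ x • m ≠ 0 := by
    by_contra! h
    have hmem : (φ x).unop ∈ annM M := h
    rw [hfaith] at hmem
    exact hφ (MulOpposite.unop_eq_zero_iff _ |>.mp hmem)
  obtain ⟨m, hm⟩ := hm
  obtain ⟨Z, hZ, g, hg⟩ := hM.exists_apply_ne_zero hm
  exact ⟨Z, hZ, g ∘ₗ LinearMap.toSpanSingleton Aᵐᵒᵖ M m ∘ₗ φ, by simpa using hg⟩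

/-- There are no nonzero maps from `C` to a finitely generated projective module. -/
lemma eq_zero_of_projective [IsArtinianRing Aᵐᵒᵖ] (hC : IsARComponent C)
    (hnoproj : ∀ X ∈ C, ¬ Module.Projective Aᵐᵒᵖ X) (hne : ¬ HasExtShortPath C)
    (hM : InAdd C M) (hfaith : annM M = {0}) {P : Modc A} (hPf : FinGen P)
    (hP : Module.Projective Aᵐᵒᵖ P) {X : Modc A} (hX : X ∈ C) (f : X →ₗ[Aᵐᵒᵖ] P) : f = 0 := by
  refine finGen_induction
    (p := fun P => Module.Projective Aᵐᵒᵖ P → ∀ f : X →ₗ[Aᵐᵒᵖ] P, f = 0) ?_ ?_ ?_ P hPf hP f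
  · intro E _ _ f
    exact Subsingleton.elim _ _
  · intro E hE hEi hEp f
    obtain ⟨x, hx⟩ := @exists_ne E hEi.1 0
    obtain ⟨Z, hZ, g, hg⟩ := exists_apply_ne_zero_of_projective hM hfaith hEp hx
    refine eq_zero_of_not_hasExtShortPath hC hne hE hEi (fun h => hnoproj E h hEp) hX hZ
      (g := g) ?_ f
    rintro rfl
    exact hg rfl
  · intro E E₁ E₂ j₁ q₁ j₂ q₂ h₁ h₂ h ih₁ ih₂ hE f
    have h1 := ih₁ (Module.Projective.of_split j₁ q₁ h₁) (q₁ ∘ₗ f)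
    have h2 := ih₂ (Module.Projective.of_split j₂ q₂ h₂) (q₂ ∘ₗ f)
    rw [← LinearMap.id_comp f, ← h, LinearMap.add_comp, LinearMap.comp_assoc,
      LinearMap.comp_assoc, h1, h2]
    simp

/-- Submodules of finitely generated projective modules have projective first syzygies. -/
lemma projective_ker_of_injective [IsArtinianRing Aᵐᵒᵖ] (hC : IsARComponent C)
    (hnoproj : ∀ X ∈ C, ¬ Module.Projective Aᵐᵒᵖ X) (hne : ¬ HasExtShortPath C)
    (hM : InAdd C M) (hfaith : annM M = {0}) {X P P₀ : Modc A} (hPf : FinGen P)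
    (hP : Module.Projective Aᵐᵒᵖ P) {i : X →ₗ[Aᵐᵒᵖ] P} (hi : Function.Injective i)
    (hP₀f : FinGen P₀) (hP₀ : Module.Projective Aᵐᵒᵖ P₀) (π : P₀ →ₗ[Aᵐᵒᵖ] X) :
    Module.Projective Aᵐᵒᵖ (LinearMap.ker π) := by
  have : Module.Finite Aᵐᵒᵖ P₀ := hP₀f
  have : Module.Finite Aᵐᵒᵖ M := hM.finGen hC
  have hMf : ∀ r : Aᵐᵒᵖ, (∀ m : M, r • m = 0) → r = 0 := by
    intro r hr
    have hmem : r.unop ∈ annM M := hr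
    rw [hfaith] at hmem
    exact MulOpposite.unop_eq_zero_iff _ |>.mp hmem
  have hCX : ∀ Z ∈ C, ∀ f : Z →ₗ[Aᵐᵒᵖ] X, f = 0 := by
    intro Z hZ f
    have h0 := eq_zero_of_projective hC hnoproj hne hM hfaith hPf hP hZ (i ∘ₗ f)
    ext1 m
    exact hi (by simpa using LinearMap.congr_fun h0 m)
  refine projective_ker_of_forall_exists_endomorphism hMf (X := X) ?_ π
  intro E _ _ hE
  refine finGen_induction (p := fun E => ∃ e : E →ₗ[Aᵐᵒᵖ] E, (∀ f : M →ₗ[Aᵐᵒᵖ] E, e ∘ₗ f = 0) ∧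
    ∀ g : E →ₗ[Aᵐᵒᵖ] X, g ∘ₗ e = g) ?_ ?_ ?_ (ModuleCat.of Aᵐᵒᵖ E) hE
  · intro E _
    exact ⟨0, fun f => by simp, fun g => Subsingleton.elim _ _⟩
  · intro E hE hEi
    by_cases hEX : ∀ g : E →ₗ[Aᵐᵒᵖ] X, g = 0
    · exact ⟨0, fun f => by simp, fun g => by simp [hEX g]⟩
    · obtain ⟨g, hg⟩ := not_forall.mp hEX
      obtain ⟨x, hx⟩ : ∃ x, g x ≠ 0 := by
        by_contra! h
        exact hg (LinearMap.ext h)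
      have hix : i (g x) ≠ 0 := fun h => hx (hi (by rw [h, map_zero]))
      obtain ⟨Z, hZ, h, hh⟩ := exists_apply_ne_zero_of_projective hM hfaith hP hix
      refine ⟨LinearMap.id, fun f => ?_, fun g => LinearMap.comp_id g⟩
      rw [LinearMap.id_comp]
      by_contra hf
      obtain ⟨Y, hY, f', hf'⟩ := hM.exists_ne_zero_from hf
      refine hf' (eq_zero_of_not_hasExtShortPath hC hne hE hEi (fun hEC => hg (hCX E hEC g)) hY hZ
        (g := h ∘ₗ i ∘ₗ g) (fun h0 => hh ?_) f')
      exact LinearMap.congr_fun h0 x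
  · rintro E E₁ E₂ j₁ q₁ j₂ q₂ h₁ h₂ h ⟨e₁, ha₁, hb₁⟩ ⟨e₂, ha₂, hb₂⟩
    refine ⟨j₁ ∘ₗ e₁ ∘ₗ q₁ + j₂ ∘ₗ e₂ ∘ₗ q₂, fun f => ?_, fun g => ?_⟩
    · rw [LinearMap.add_comp]
      simp only [LinearMap.comp_assoc, ha₁, ha₂, LinearMap.comp_zero, add_zero]
    · rw [LinearMap.comp_add]
      rw [← LinearMap.comp_assoc, ← LinearMap.comp_assoc, ← LinearMap.comp_assoc,
        ← LinearMap.comp_assoc, hb₁, hb₂, LinearMap.comp_assoc, LinearMap.comp_assoc,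
        ← LinearMap.comp_add, h, LinearMap.comp_id]

/-- Submodules of finitely generated projective modules have projective dimension at most 1. -/
lemma pdLE1_of_injective [IsArtinianRing Aᵐᵒᵖ] (hC : IsARComponent C)
    (hnoproj : ∀ X ∈ C, ¬ Module.Projective Aᵐᵒᵖ X) (hne : ¬ HasExtShortPath C)
    (hM : InAdd C M) (hfaith : annM M = {0}) {X P : Modc A} (hPf : FinGen P)
    (hP : Module.Projective Aᵐᵒᵖ P) {i : X →ₗ[Aᵐᵒᵖ] P} (hi : Function.Injective i) :
    PdLE1 X := by
  have : Module.Finite Aᵐᵒᵖ P := hPf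
  have : Module.Finite Aᵐᵒᵖ X := Module.Finite.of_injective i hi
  obtain ⟨n, π, hπ⟩ := Module.Finite.exists_fin' Aᵐᵒᵖ X
  have hfin : FinGen (ModuleCat.of Aᵐᵒᵖ (Fin n → Aᵐᵒᵖ)) :=
    inferInstanceAs (Module.Finite Aᵐᵒᵖ (Fin n → Aᵐᵒᵖ))
  have hproj : Module.Projective Aᵐᵒᵖ (ModuleCat.of Aᵐᵒᵖ (Fin n → Aᵐᵒᵖ)) :=
    inferInstanceAs (Module.Projective Aᵐᵒᵖ (Fin n → Aᵐᵒᵖ))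
  exact ⟨ModuleCat.of Aᵐᵒᵖ (LinearMap.ker π), ModuleCat.of Aᵐᵒᵖ (Fin n → Aᵐᵒᵖ),
    (LinearMap.ker π).subtype, π,
    projective_ker_of_injective hC hnoproj hne hM hfaith hPf hP hi hfin hproj π, hproj,
    (LinearMap.ker π).injective_subtype, hπ, Submodule.range_subtype _⟩

end Component

/-- For a component `C` without projectives and without
external short paths admitting a faithful module in `add C`: every
indecomposable direct summand of `rad P` (for `P` indecomposable projective)
not lying in `C` has projective dimension at most 1, and `gldim A ≤ 2`. -/
theorem pd_rad_le_one_and_gldim_le_two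
    (K : Type u) [CommRing K] [IsArtinianRing K]
    (A : Type u) [Ring A] [Algebra K A] [Module.Finite K A]
    (C : Set (Modc A)) (hC : IsARComponent C)
    (hnoproj : ∀ X ∈ C, ¬ Module.Projective Aᵐᵒᵖ X)
    (hne : ¬ HasExtShortPath C)
    (M : Modc A) (hM : InAdd C M) (hfaith : annM M = {0}) :
    (∀ P X : Modc A, FinGen P → Indec P → Module.Projective Aᵐᵒᵖ P →
      FinGen X → Indec X →
      IsDirectSummandOf X (ModuleCat.of Aᵐᵒᵖ ↥(radMod P)) →
      X ∉ C → PdLE1 X) ∧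
    (∀ N : Modc A, FinGen N → PdLE2 N) := by
  have : IsArtinianRing Aᵐᵒᵖ := IsArtinianRing.of_finite K Aᵐᵒᵖ
  refine ⟨fun P X hPf _ hP _ _ ⟨ι, ρ, hρ⟩ _ => ?_, fun N hN => ?_⟩
  · exact pdLE1_of_injective hC hnoproj hne hM hfaith hPf hP (i := (radMod P).subtype ∘ₗ ι)
      ((radMod P).injective_subtype.comp
        (Function.LeftInverse.injective (LinearMap.congr_fun hρ)))
  · have : Module.Finite Aᵐᵒᵖ N := hN
    obtain ⟨n, π, hπ⟩ := Module.Finite.exists_fin' Aᵐᵒᵖ N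
    have hproj : Module.Projective Aᵐᵒᵖ (ModuleCat.of Aᵐᵒᵖ (Fin n → Aᵐᵒᵖ)) :=
      inferInstanceAs (Module.Projective Aᵐᵒᵖ (Fin n → Aᵐᵒᵖ))
    obtain ⟨P₂, P₁, f, g, hP₂, hP₁, hf, hg, hfg⟩ := pdLE1_of_injective hC hnoproj hne hM hfaith
      (X := ModuleCat.of Aᵐᵒᵖ (LinearMap.ker π)) (P := ModuleCat.of Aᵐᵒᵖ (Fin n → Aᵐᵒᵖ))
      (inferInstanceAs (Module.Finite Aᵐᵒᵖ (Fin n → Aᵐᵒᵖ))) hproj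
      (LinearMap.ker π).injective_subtype
    refine ⟨P₂, P₁, ModuleCat.of Aᵐᵒᵖ (Fin n → Aᵐᵒᵖ), f, (LinearMap.ker π).subtype ∘ₗ g, π,
      hP₂, hP₁, hproj, hf, hπ, ?_, ?_⟩
    · rw [hfg, LinearMap.ker_comp_of_ker_eq_bot _ (Submodule.ker_subtype _)]
    · rw [LinearMap.range_comp_of_range_eq_top _ (LinearMap.range_eq_top.mpr hg)]
      exact Submodule.range_subtype _
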